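/- arXiv:2605.12157 — 7 statements merged into one kernel-verified Lean document; each statement's English description precedes it below -/
import Mathlib

section
/- (Second shifting property) Let 0 < α ≤ 1, let f : (0,∞) → ℂ be measurable, let a ≥ 0 and s ∈ ℂ, and suppose t ↦ exp(−s·t^α/α)·t^(α−1)·f(t) is Lebesgue integrable on (0,∞). Then ∫₀^∞ exp(−s·t^α/α)·t^(α−1)·𝟙_{t > a}·f((t^α − a^α)^(1/α)) dt = exp(−s·a^α/α)·∫₀^∞ exp(−s·t^α/α)·t^(α−1)·f(t) dt, where 𝟙_{t > a} denotes the indicator of (a,∞). That is, L_0^α{u_a(t)·f((t^α − a^α)^(1/α))}(s) = exp(−s·a^α/α)·L_0^α{f}(s). -/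
open MeasureTheory

/-- Second shifting property:
`L_0^α{u_a(t)·f((t^α − a^α)^(1/α))}(s) = exp(−s·a^α/α)·L_0^α{f}(s)` for `a ≥ 0`,
where `u_a` is the Heaviside step function at `a` (the indicator of `(a,∞)`). -/
theorem conformableLaplace_second_shift
    (α : ℝ) (hα0 : 0 < α) (hα1 : α ≤ 1) (f : ℝ → ℂ) (hf : Measurable f)
    (a : ℝ) (ha : 0 ≤ a) (s : ℂ)
    (hint : IntegrableOn
      (fun t : ℝ =>
        Complex.exp (-s * ((t ^ α / α : ℝ) : ℂ)) * ((t ^ (α - 1) : ℝ) : ℂ) * f t)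
      (Set.Ioi 0)) :
    ∫ t in Set.Ioi (0 : ℝ),
        Complex.exp (-s * ((t ^ α / α : ℝ) : ℂ)) * ((t ^ (α - 1) : ℝ) : ℂ) *
          Set.indicator (Set.Ioi a) (fun t : ℝ => f ((t ^ α - a ^ α) ^ (1 / α))) t =
    Complex.exp (-s * ((a ^ α / α : ℝ) : ℂ)) *
      ∫ t in Set.Ioi (0 : ℝ),
        Complex.exp (-s * ((t ^ α / α : ℝ) : ℂ)) * ((t ^ (α - 1) : ℝ) : ℂ) * f t := by
  have hαne : α ≠ 0 := hα0.ne'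
  have hc : 0 ≤ a ^ α := Real.rpow_nonneg ha α
  have hca : (a ^ α) ^ α⁻¹ = a := Real.rpow_rpow_inv ha hαne
  have h1 := integral_comp_rpow_Ioi_of_pos' (E := ℂ)
    (g := fun y : ℝ => (α : ℂ)⁻¹ * (Complex.exp (-s * ((y / α : ℝ) : ℂ)) *
      f ((y - a ^ α) ^ (1 / α)))) hα0 hc
  have h2 := integral_comp_rpow_Ioi_of_pos (E := ℂ)
    (g := fun y : ℝ => (α : ℂ)⁻¹ * (Complex.exp (-s * ((y / α : ℝ) : ℂ)) *
      f (y ^ (1 / α)))) hα0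
  rw [hca] at h1
  have hαc : (α : ℂ) ≠ 0 := by exact_mod_cast hαne
  have hL : ∫ t in Set.Ioi (0 : ℝ),
        Complex.exp (-s * ((t ^ α / α : ℝ) : ℂ)) * ((t ^ (α - 1) : ℝ) : ℂ) *
          Set.indicator (Set.Ioi a) (fun t : ℝ => f ((t ^ α - a ^ α) ^ (1 / α))) t =
      ∫ y in Set.Ioi (a ^ α), (α : ℂ)⁻¹ * (Complex.exp (-s * ((y / α : ℝ) : ℂ)) *
      f ((y - a ^ α) ^ (1 / α))) := by
    rw [← h1, ← integral_indicator measurableSet_Ioi, ← integral_indicator measurableSet_Ioi]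
    congr 1
    ext t
    by_cases ht : a < t
    · have ht0 : 0 < t := ha.trans_lt ht
      rw [Set.indicator_of_mem (show t ∈ Set.Ioi (0 : ℝ) from ht0),
        Set.indicator_of_mem (show t ∈ Set.Ioi a from ht),
        Set.indicator_of_mem (show t ∈ Set.Ioi a from ht), Complex.real_smul,
        Complex.ofReal_mul]
      field_simp
    · rw [Set.indicator_of_notMem (s := Set.Ioi a) (by simpa using ht)]
      simp [Set.indicator, ht]
  have hR : ∫ t in Set.Ioi (0 : ℝ),
        Complex.exp (-s * ((t ^ α / α : ℝ) : ℂ)) * ((t ^ (α - 1) : ℝ) : ℂ) * f t =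
      ∫ y in Set.Ioi (0 : ℝ), (α : ℂ)⁻¹ * (Complex.exp (-s * ((y / α : ℝ) : ℂ)) *
      f (y ^ (1 / α))) := by
    rw [← h2]
    refine setIntegral_congr_fun measurableSet_Ioi fun t ht => ?_
    have e : (t ^ α) ^ (1 / α) = t := by
      rw [one_div]; exact Real.rpow_rpow_inv (le_of_lt ht) hαne
    simp only [e]
    rw [Complex.real_smul, Complex.ofReal_mul]
    field_simp
  rw [hL, hR, ← integral_const_mul, ← integral_indicator measurableSet_Ioi,
    ← integral_indicator measurableSet_Ioi, ← integral_add_right_eq_self _ (a ^ α)]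
  congr 1
  ext y
  by_cases hy : 0 < y
  · rw [Set.indicator_of_mem (show y ∈ Set.Ioi (0 : ℝ) from hy),
      Set.indicator_of_mem (show y + a ^ α ∈ Set.Ioi (a ^ α) by simpa using hy),
      add_sub_cancel_right, add_div, Complex.ofReal_add, mul_add, Complex.exp_add]
    ring
  · rw [Set.indicator_of_notMem (by simpa using hy), Set.indicator_of_notMem (by simpa using hy)]
end

section
/- (Transform of the conformable derivative, case β = α) Let 0 < α ≤ 1, let f : [0,∞) → ℂ be continuous on [0,∞) and differentiable on (0,∞), and let s > 0 be real. Suppose that t ↦ exp(−s·t^α/α)·f'(t) and t ↦ exp(−s·t^α/α)·t^(α−1)·f(t) are Lebesgue integrable on (0,∞), and that exp(−s·t^α/α)·f(t) → 0 as t → ∞. Then ∫₀^∞ exp(−s·t^α/α)·f'(t) dt = s·∫₀^∞ exp(−s·t^α/α)·t^(α−1)·f(t) dt − f(0); that is, L_0^α{T_α f}(s) = s·L_0^α{f}(s) − f(0). -/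
open MeasureTheory Filter Topology

/-- Transform of the conformable derivative for `β = α`:
`L_0^α{T_α f}(s) = s·L_0^α{f}(s) − f(0)`, where
`exp(−s t^α/α)·t^(α−1)·T_α f(t) = exp(−s t^α/α)·f'(t)`. -/
theorem conformableLaplace_conformableDeriv_self
    (α : ℝ) (hα0 : 0 < α) (hα1 : α ≤ 1) (f f' : ℝ → ℂ)
    (hcont : ContinuousOn f (Set.Ici 0))
    (hderiv : ∀ t ∈ Set.Ioi (0 : ℝ), HasDerivAt f (f' t) t)
    (s : ℝ) (hs : 0 < s)
    (h1 : IntegrableOn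
      (fun t : ℝ => Complex.exp (-(s : ℂ) * ((t ^ α / α : ℝ) : ℂ)) * f' t) (Set.Ioi 0))
    (h2 : IntegrableOn
      (fun t : ℝ =>
        Complex.exp (-(s : ℂ) * ((t ^ α / α : ℝ) : ℂ)) * ((t ^ (α - 1) : ℝ) : ℂ) * f t)
      (Set.Ioi 0))
    (htop : Tendsto
      (fun t : ℝ => Complex.exp (-(s : ℂ) * ((t ^ α / α : ℝ) : ℂ)) * f t) atTop (𝓝 0)) :
    ∫ t in Set.Ioi (0 : ℝ), Complex.exp (-(s : ℂ) * ((t ^ α / α : ℝ) : ℂ)) * f' t =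
      (s : ℂ) *
        (∫ t in Set.Ioi (0 : ℝ),
          Complex.exp (-(s : ℂ) * ((t ^ α / α : ℝ) : ℂ)) * ((t ^ (α - 1) : ℝ) : ℂ) * f t)
      - f 0 := by
  have hd : ∀ t ∈ Set.Ioi (0 : ℝ), HasDerivAt
      (fun t : ℝ => Complex.exp (-(s : ℂ) * ((t ^ α / α : ℝ) : ℂ)) * f t)
      (Complex.exp (-(s : ℂ) * ((t ^ α / α : ℝ) : ℂ)) * f' t - (s : ℂ) *
        (Complex.exp (-(s : ℂ) * ((t ^ α / α : ℝ) : ℂ)) * ((t ^ (α - 1) : ℝ) : ℂ) * f t)) t := by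
    intro t ht
    have hp : HasDerivAt (fun t : ℝ => t ^ α / α) (t ^ (α - 1)) t := by
      have h := (Real.hasDerivAt_rpow_const (x := t) (p := α) (Or.inl (ne_of_gt ht))).div_const α
      rwa [mul_div_assoc, mul_div_cancel₀ _ hα0.ne'] at h
    have he := ((hp.ofReal_comp).const_mul (-(s : ℂ))).cexp
    refine (he.mul (hderiv t ht)).congr_deriv ?_
    ring
  have hc : ContinuousWithinAt
      (fun t : ℝ => Complex.exp (-(s : ℂ) * ((t ^ α / α : ℝ) : ℂ)) * f t) (Set.Ici 0) 0 := by
    refine ContinuousWithinAt.mul ?_ (hcont 0 Set.self_mem_Ici)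
    have : Continuous fun t : ℝ => t ^ α / α := (Real.continuous_rpow_const hα0.le).div_const α
    apply Continuous.continuousWithinAt
    fun_prop
  have key := integral_Ioi_of_hasDerivAt_of_tendsto hc hd (h1.sub (h2.const_mul (s : ℂ))) htop
  rw [integral_sub h1 (h2.const_mul (s : ℂ)), integral_const_mul] at key
  simp only [Real.zero_rpow hα0.ne', zero_div, Complex.ofReal_zero, mul_zero, Complex.exp_zero,
    one_mul, zero_sub] at key
  linear_combination key
end

section
/- (Transform of the conformable integral) Let 0 < α ≤ 1, 0 < β ≤ 1, let f : (0,∞) → ℂ be measurable, and let s > 0 be real. Suppose that t ↦ exp(−s·t^α/α)·t^(β−1)·f(t) is Lebesgue integrable on (0,∞) and that p ↦ p^(β−1)·f(p) is Lebesgue integrable on (0,t) for every t > 0. Define g(t) = ∫₀^t f(p)·p^(β−1) dp. Then ∫₀^∞ exp(−s·t^α/α)·t^(α−1)·g(t) dt = (1/s)·∫₀^∞ exp(−s·t^α/α)·t^(β−1)·f(t) dt. -/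
open MeasureTheory


lemma aux_kernel (α s : ℝ) (hα0 : 0 < α) (hs : 0 < s) (p : ℝ) (hp : 0 < p) :
    IntegrableOn (fun t : ℝ => Real.exp (-s * (t ^ α / α)) * t ^ (α - 1)) (Set.Ioi p) ∧
    ∫ t in Set.Ioi p, Real.exp (-s * (t ^ α / α)) * t ^ (α - 1)
      = Real.exp (-s * (p ^ α / α)) / s := by
  have hd : ∀ x ∈ Set.Ici p, HasDerivAt (fun t : ℝ => Real.exp (-s * (t ^ α / α)) / s)
      (-(Real.exp (-s * (x ^ α / α)) * x ^ (α - 1))) x := by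
    intro x hx
    have hx0 : 0 < x := lt_of_lt_of_le hp hx
    have h1 := Real.hasDerivAt_rpow_const (x := x) (p := α) (Or.inl hx0.ne')
    refine ((((h1.div_const α).const_mul (-s)).exp).div_const s).congr_deriv ?_
    field_simp
  have hneg : ∀ x ∈ Set.Ioi p, -(Real.exp (-s * (x ^ α / α)) * x ^ (α - 1)) ≤ 0 := by
    intro x hx
    have hx0 : 0 < x := lt_trans hp hx
    have : 0 ≤ Real.exp (-s * (x ^ α / α)) * x ^ (α - 1) := by positivity
    linarith
  have hlim : Filter.Tendsto (fun t : ℝ => Real.exp (-s * (t ^ α / α)) / s) Filter.atTop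
      (nhds 0) := by
    have h1 : Filter.Tendsto (fun t : ℝ => -s * (t ^ α / α)) Filter.atTop Filter.atBot :=
      ((tendsto_rpow_atTop hα0).atTop_div_const hα0).const_mul_atTop_of_neg (by linarith)
    simpa using (Real.tendsto_exp_atBot.comp h1).div_const s
  constructor
  · simpa using (integrableOn_Ioi_deriv_of_nonpos' hd hneg hlim).neg
  · have := integral_Ioi_of_hasDerivAt_of_nonpos' hd hneg hlim
    rw [integral_neg] at this
    linarith

lemma aux_fubini (k E : ℝ → ℝ) (h : ℝ → ℂ) (hk : Measurable k) (hh : Measurable h) (s : ℝ)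
    (hk0 : ∀ t, 0 < t → 0 ≤ k t)
    (hki : ∀ p, 0 < p → IntegrableOn k (Set.Ioi p) ∧ ∫ t in Set.Ioi p, k t = E p / s)
    (hE : IntegrableOn (fun p => (E p : ℂ) * h p) (Set.Ioi 0))
    (hE0 : ∀ p, 0 < p → 0 ≤ E p) :
    ∫ t in Set.Ioi (0:ℝ), (k t : ℂ) * (∫ p in Set.Ioo (0:ℝ) t, h p)
      = (1 / (s:ℂ)) * ∫ p in Set.Ioi (0:ℝ), (E p : ℂ) * h p := by
  set μ : Measure ℝ := volume.restrict (Set.Ioi 0) with hμ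
  let F : ℝ → ℝ → ℂ := fun t p => if p < t then (k t : ℂ) * h p else 0
  have hFm : Measurable (Function.uncurry F) := by
    refine Measurable.ite (measurableSet_lt measurable_snd measurable_fst) ?_ measurable_const
    fun_prop
  have hFp : ∀ p, (fun t => F t p) = (Set.Ioi p).indicator (fun t => (k t : ℂ) * h p) := by
    intro p; ext t; simp [F, Set.indicator_apply]
  have hFt : ∀ t, (fun p => F t p) = (Set.Iio t).indicator (fun p => (k t : ℂ) * h p) := by
    intro t; ext p; simp [F, Set.indicator_apply]
  have hres : ∀ p, 0 < p → μ.restrict (Set.Ioi p) = volume.restrict (Set.Ioi p) := by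
    intro p hp
    rw [hμ, Measure.restrict_restrict measurableSet_Ioi, Set.inter_eq_left.2]
    exact Set.Ioi_subset_Ioi hp.le
  have hFi : Integrable (Function.uncurry F) (μ.prod μ) := by
    rw [integrable_prod_iff' hFm.aestronglyMeasurable]
    constructor
    · filter_upwards [ae_restrict_mem measurableSet_Ioi] with p hp
      simp only [Function.uncurry_apply_pair]
      rw [hFp, integrable_indicator_iff measurableSet_Ioi, IntegrableOn, hres p hp]
      exact ((hki p hp).1.ofReal).mul_const _
    · have := (hE.norm).div_const s
      refine this.congr ?_
      filter_upwards [ae_restrict_mem measurableSet_Ioi] with p hp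
      have e : (fun t => ‖F t p‖) = (Set.Ioi p).indicator (fun t => ‖k t‖ * ‖h p‖) := by
        ext t
        rw [show F t p = _ from congrFun (hFp p) t, norm_indicator_eq_indicator_norm]
        simp
      simp only [Function.uncurry_apply_pair]
      rw [e, integral_indicator measurableSet_Ioi, hres p hp, integral_mul_const,
        setIntegral_congr_fun (g := k) measurableSet_Ioi, (hki p hp).2]
      · simp [abs_of_nonneg (hE0 p hp)]; ring
      · intro t ht
        exact Real.norm_of_nonneg (hk0 t (lt_trans hp ht))
  have hsw := integral_integral_swap hFi
  have hL : ∀ t, ∫ p, F t p ∂μ = (k t : ℂ) * ∫ p in Set.Ioo (0:ℝ) t, h p := by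
    intro t
    rw [hFt, integral_indicator measurableSet_Iio, hμ,
      Measure.restrict_restrict measurableSet_Iio, integral_const_mul, Set.Iio_inter_Ioi]
  simp only [hL] at hsw
  rw [hsw, ← integral_const_mul]
  refine integral_congr_ae ?_
  filter_upwards [ae_restrict_mem measurableSet_Ioi] with p hp
  rw [hFp, integral_indicator measurableSet_Ioi, hres p hp, integral_mul_const,
    integral_complex_ofReal, (hki p hp).2]
  push_cast
  ring

/-- Transform of the conformable integral `g(t) = ∫₀^t f(p) p^(β−1) dp`:
`L_0^α{g}(s) = (1/s)·L_0^α{t^(α−β) f(t)}(s)`, i.e.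
`∫₀^∞ e^{−s t^α/α} t^{α−1} g(t) dt = (1/s)·∫₀^∞ e^{−s t^α/α} t^{β−1} f(t) dt`. -/
theorem conformableLaplace_conformableIntegral
    (α β : ℝ) (hα0 : 0 < α) (hα1 : α ≤ 1) (hβ0 : 0 < β) (hβ1 : β ≤ 1)
    (f : ℝ → ℂ) (hf : Measurable f) (s : ℝ) (hs : 0 < s)
    (hloc : ∀ t : ℝ, 0 < t →
      IntegrableOn (fun p : ℝ => f p * ((p ^ (β - 1) : ℝ) : ℂ)) (Set.Ioo 0 t))
    (hint : IntegrableOn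
      (fun t : ℝ =>
        Complex.exp (-(s : ℂ) * ((t ^ α / α : ℝ) : ℂ)) * ((t ^ (β - 1) : ℝ) : ℂ) * f t)
      (Set.Ioi 0)) :
    ∫ t in Set.Ioi (0 : ℝ),
        Complex.exp (-(s : ℂ) * ((t ^ α / α : ℝ) : ℂ)) * ((t ^ (α - 1) : ℝ) : ℂ) *
          (∫ p in Set.Ioo (0 : ℝ) t, f p * ((p ^ (β - 1) : ℝ) : ℂ)) =
    (1 / (s : ℂ)) *
      ∫ t in Set.Ioi (0 : ℝ),
        Complex.exp (-(s : ℂ) * ((t ^ α / α : ℝ) : ℂ)) * ((t ^ (β - 1) : ℝ) : ℂ) * f t := by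
  have hc : ∀ t : ℝ, Complex.exp (-(s : ℂ) * ((t ^ α / α : ℝ) : ℂ))
      = ((Real.exp (-s * (t ^ α / α)) : ℝ) : ℂ) := by
    intro t; push_cast; rfl
  have key := aux_fubini (fun t : ℝ => Real.exp (-s * (t ^ α / α)) * t ^ (α - 1))
    (fun t => Real.exp (-s * (t ^ α / α))) (fun p : ℝ => f p * ((p ^ (β - 1) : ℝ) : ℂ))
    (by fun_prop) (by fun_prop) s (fun t ht => by positivity)
    (fun p hp => aux_kernel α s hα0 hs p hp)
    (by
      refine hint.congr_fun (fun t _ => ?_) measurableSet_Ioi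
      simp only [hc]; ring)
    (fun p hp => by positivity)
  simp only [hc]
  convert key using 4
  · push_cast; ring
  · ring
end

section
/- (Commutativity of the conformable convolution) Let 0 < α ≤ 1, let f, g : (0,∞) → ℂ be measurable, and let t > 0. If p ↦ f(p)·g((t^α − p^α)^(1/α))·p^(α−1) is Lebesgue integrable on (0,t), then so is p ↦ g(p)·f((t^α − p^α)^(1/α))·p^(α−1), and ∫₀^t f(p)·g((t^α − p^α)^(1/α))·p^(α−1) dp = ∫₀^t g(p)·f((t^α − p^α)^(1/α))·p^(α−1) dp; that is, (f *_α g)(t) = (g *_α f)(t). -/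
open MeasureTheory

/-- Commutativity of the conformable fractional convolution:
if `p ↦ f(p)·g((t^α − p^α)^(1/α))·p^(α−1)` is integrable on `(0,t)`, then so is the
swapped integrand, and `(f *_α g)(t) = (g *_α f)(t)`. -/
theorem conformableConvolution_comm
    (α : ℝ) (hα0 : 0 < α) (hα1 : α ≤ 1) (f g : ℝ → ℂ)
    (hf : Measurable f) (hg : Measurable g) (t : ℝ) (ht : 0 < t)
    (hint : IntegrableOn
      (fun p : ℝ => f p * g ((t ^ α - p ^ α) ^ (1 / α)) * ((p ^ (α - 1) : ℝ) : ℂ))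
      (Set.Ioo 0 t)) :
    IntegrableOn
      (fun p : ℝ => g p * f ((t ^ α - p ^ α) ^ (1 / α)) * ((p ^ (α - 1) : ℝ) : ℂ))
      (Set.Ioo 0 t) ∧
    ∫ p in Set.Ioo (0 : ℝ) t,
        f p * g ((t ^ α - p ^ α) ^ (1 / α)) * ((p ^ (α - 1) : ℝ) : ℂ) =
    ∫ p in Set.Ioo (0 : ℝ) t,
        g p * f ((t ^ α - p ^ α) ^ (1 / α)) * ((p ^ (α - 1) : ℝ) : ℂ) := by
  set φ : ℝ → ℝ := fun p => (t ^ α - p ^ α) ^ (1 / α) with hφ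
  have hu : ∀ p ∈ Set.Ioo 0 t, 0 < t ^ α - p ^ α := fun p hp =>
    sub_pos.2 (Real.rpow_lt_rpow hp.1.le hp.2 hα0)
  have hpow : ∀ p ∈ Set.Ioo 0 t, (φ p) ^ α = t ^ α - p ^ α := by
    intro p hp
    simp only [hφ]
    rw [← Real.rpow_mul (hu p hp).le, one_div_mul_cancel hα0.ne', Real.rpow_one]
  have hmaps : ∀ p ∈ Set.Ioo 0 t, φ p ∈ Set.Ioo 0 t := by
    intro p hp
    have h0 : 0 < φ p := Real.rpow_pos_of_pos (hu p hp) _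
    refine ⟨h0, ?_⟩
    rw [← Real.rpow_lt_rpow_iff h0.le ht.le hα0, hpow p hp]
    have := Real.rpow_pos_of_pos hp.1 α
    linarith
  have hinv : ∀ p ∈ Set.Ioo 0 t, φ (φ p) = p := by
    intro p hp
    have h1 : φ (φ p) = (t ^ α - (φ p) ^ α) ^ (1 / α) := rfl
    rw [h1, hpow p hp, sub_sub_cancel, ← Real.rpow_mul hp.1.le, mul_one_div_cancel hα0.ne',
      Real.rpow_one]
  have himg : φ '' Set.Ioo 0 t = Set.Ioo 0 t := by
    ext x
    constructor
    · rintro ⟨p, hp, rfl⟩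
      exact hmaps p hp
    · intro hx
      exact ⟨φ x, hmaps x hx, hinv x hx⟩
  have hinj : Set.InjOn φ (Set.Ioo 0 t) := by
    intro x hx y hy hxy
    rw [← hinv x hx, hxy, hinv y hy]
  let φ' : ℝ → ℝ := fun p => -(p ^ (α - 1) * (t ^ α - p ^ α) ^ (1 / α - 1))
  have hder : ∀ p ∈ Set.Ioo 0 t, HasDerivWithinAt φ (φ' p) (Set.Ioo 0 t) p := by
    intro p hp
    have h1 := (Real.hasDerivAt_rpow_const (x := p) (p := α) (Or.inl hp.1.ne')).const_sub (t ^ α)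
    have h2 := h1.rpow_const (p := 1 / α) (Or.inl (hu p hp).ne')
    refine (h2.congr_deriv ?_).hasDerivWithinAt
    simp only [φ']
    field_simp
  have hjac : ∀ p ∈ Set.Ioo 0 t, |φ' p| * (φ p) ^ (α - 1) = p ^ (α - 1) := by
    intro p hp
    have hp1 := Real.rpow_pos_of_pos hp.1 (α - 1)
    have hu1 := Real.rpow_pos_of_pos (hu p hp) (1 / α - 1)
    simp only [φ', abs_neg]
    rw [abs_of_pos (mul_pos hp1 hu1), hφ]
    simp only
    rw [← Real.rpow_mul (hu p hp).le, mul_assoc, ← Real.rpow_add (hu p hp)]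
    have : 1 / α - 1 + 1 / α * (α - 1) = 0 := by field_simp; ring
    rw [this, Real.rpow_zero, mul_one]
  have hcongr : ∀ p ∈ Set.Ioo 0 t,
      |φ' p| • (f (φ p) * g (φ (φ p)) * (((φ p) ^ (α - 1) : ℝ) : ℂ)) =
        g p * f (φ p) * ((p ^ (α - 1) : ℝ) : ℂ) := by
    intro p hp
    rw [hinv p hp, ← hjac p hp, Complex.real_smul]
    push_cast
    ring
  constructor
  · have h := (integrableOn_image_iff_integrableOn_abs_deriv_smul measurableSet_Ioo hder hinj
      (fun p : ℝ => f p * g (φ p) * ((p ^ (α - 1) : ℝ) : ℂ))).1 (by rw [himg]; exact hint)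
    exact h.congr_fun hcongr measurableSet_Ioo
  · have h := integral_image_eq_integral_abs_deriv_smul measurableSet_Ioo hder hinj
      (fun p : ℝ => f p * g (φ p) * ((p ^ (α - 1) : ℝ) : ℂ))
    rw [himg] at h
    exact h.trans (setIntegral_congr_fun measurableSet_Ioo hcongr)
end

section
/- (Associativity of the conformable convolution) Let 0 < α ≤ 1 and let f, g, h : (0,∞) → [0,∞) be nonnegative measurable functions. Then for every t > 0, (f *_α (g *_α h))(t) = ((f *_α g) *_α h)(t), where both sides are Lebesgue integrals with values in [0,∞]. -/
open MeasureTheory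

/-- Conformable fractional convolution of `[0,∞]`-valued functions (lower integral):
`(F *_α G)(t) = ∫₀^t F(p)·G((t^α − p^α)^(1/α))·p^(α−1) dp`. -/
noncomputable def ennConformableConv (α : ℝ) (F G : ℝ → ENNReal) (t : ℝ) : ENNReal :=
  ∫⁻ p in Set.Ioo 0 t, F p * G ((t ^ α - p ^ α) ^ (1 / α)) * ENNReal.ofReal (p ^ (α - 1))

/-- Transport to the additive convolution. -/
noncomputable def trT (α : ℝ) (F : ℝ → ENNReal) : ℝ → ENNReal :=
  Set.indicator (Set.Ioi 0) (fun u => F (u ^ (1 / α)))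

lemma trT_meas (α : ℝ) (F : ℝ → ENNReal) (hF : Measurable F) : Measurable (trT α F) := by
  unfold trT
  refine Measurable.indicator ?_ measurableSet_Ioi
  exact hF.comp (by fun_prop)

lemma lconv_eq (α : ℝ) (F G : ℝ → ENNReal) (x : ℝ) :
    lconvolution (trT α F) (trT α G) volume x
      = ∫⁻ y in Set.Ioo 0 x, F (y ^ (1 / α)) * G ((x - y) ^ (1 / α)) := by
  rw [lconvolution_def, ← lintegral_indicator measurableSet_Ioo]
  congr 1
  ext y
  simp only [trT, Set.indicator_apply, Set.mem_Ioi, Set.mem_Ioo]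
  by_cases h1 : 0 < y <;> by_cases h2 : y < x <;> simp [h1, h2, neg_add_eq_sub]

lemma conv_eq (α : ℝ) (hα : 0 < α) (F G : ℝ → ENNReal) (t : ℝ) (ht : 0 < t) :
    ennConformableConv α F G t
      = ENNReal.ofReal (1 / α) * lconvolution (trT α F) (trT α G) volume (t ^ α) := by
  have him : (fun p : ℝ => p ^ α) '' Set.Ioo 0 t = Set.Ioo 0 (t ^ α) := by
    ext y
    constructor
    · rintro ⟨p, ⟨h0, h1⟩, rfl⟩
      exact ⟨Real.rpow_pos_of_pos h0 _, Real.rpow_lt_rpow h0.le h1 hα⟩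
    · rintro ⟨h0, h1⟩
      refine ⟨y ^ (1 / α), ⟨Real.rpow_pos_of_pos h0 _, ?_⟩, ?_⟩
      · have := Real.rpow_lt_rpow h0.le h1 (one_div_pos.2 hα)
        rwa [← Real.rpow_mul ht.le, mul_one_div_cancel hα.ne', Real.rpow_one] at this
      · simp only
        rw [← Real.rpow_mul h0.le, one_div_mul_cancel hα.ne', Real.rpow_one]
  rw [lconv_eq, ← him, lintegral_image_eq_lintegral_abs_deriv_mul
    (f' := fun p => α * p ^ (α - 1)) measurableSet_Ioo]
  · rw [← lintegral_const_mul' _ _ ENNReal.ofReal_ne_top, ennConformableConv]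
    refine setLIntegral_congr_fun measurableSet_Ioo ?_
    intro p hp
    have hp0 : 0 < p := hp.1
    have hpp := Real.rpow_pos_of_pos hp0 (α - 1)
    simp only
    rw [← mul_assoc, ← ENNReal.ofReal_mul (by positivity), abs_of_pos (by positivity),
      ← mul_assoc (1 / α), one_div_mul_cancel hα.ne', one_mul, ← Real.rpow_mul hp0.le,
      mul_one_div_cancel hα.ne', Real.rpow_one, mul_comm]
  · intro p hp
    exact (Real.hasDerivAt_rpow_const (Or.inl hp.1.ne')).hasDerivWithinAt
  · intro p hp q hq hpq
    exact (Real.rpow_left_inj hp.1.le hq.1.le hα.ne').1 hpq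

lemma trT_conv (α : ℝ) (hα : 0 < α) (F G : ℝ → ENNReal) :
    trT α (ennConformableConv α F G)
      = fun u => ENNReal.ofReal (1 / α) * lconvolution (trT α F) (trT α G) volume u := by
  ext u
  by_cases hu : 0 < u
  · rw [trT, Set.indicator_of_mem (Set.mem_Ioi.2 hu),
      conv_eq α hα F G _ (Real.rpow_pos_of_pos hu _), ← Real.rpow_mul hu.le,
      one_div_mul_cancel hα.ne', Real.rpow_one]
  · rw [trT, Set.indicator_of_notMem (by simpa using hu), lconv_eq,
      Set.Ioo_eq_empty (by simpa using hu)]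
    simp

/-- Associativity of the conformable fractional convolution for nonnegative measurable
functions `(0,∞) → [0,∞)`, both sides being Lebesgue integrals valued in `[0,∞]`. -/
theorem conformableConvolution_assoc
    (α : ℝ) (hα0 : 0 < α) (hα1 : α ≤ 1) (f g h : ℝ → NNReal)
    (hf : Measurable f) (hg : Measurable g) (hh : Measurable h)
    (t : ℝ) (ht : 0 < t) :
    ennConformableConv α (fun x => (f x : ENNReal))
        (ennConformableConv α (fun x => (g x : ENNReal)) (fun x => (h x : ENNReal))) t =
    ennConformableConv α
        (ennConformableConv α (fun x => (f x : ENNReal)) (fun x => (g x : ENNReal)))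
        (fun x => (h x : ENNReal)) t := by
  have mf := trT_meas α _ hf.coe_nnreal_ennreal
  have mg := trT_meas α _ hg.coe_nnreal_ennreal
  have mh := trT_meas α _ hh.coe_nnreal_ennreal
  rw [conv_eq α hα0 _ _ t ht, conv_eq α hα0 _ _ t ht, trT_conv α hα0, trT_conv α hα0]
  congr 1
  have key := congrFun (lconvolution_assoc (μ := volume) mf mg mh) (t ^ α)
  rw [lconvolution_def] at key ⊢
  rw [lconvolution_def] at key ⊢
  simp only [mul_left_comm _ (ENNReal.ofReal (1 / α)), mul_assoc] at key ⊢
  rw [lintegral_const_mul' _ _ ENNReal.ofReal_ne_top, lintegral_const_mul' _ _ ENNReal.ofReal_ne_top]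
  congr 1
end

section
/- (Boundedness of the conformable convolution in L¹_α) Let 0 < α ≤ 1 and let f, g : (0,∞) → ℂ be measurable functions with ∫₀^∞ |f(t)|·t^(α−1) dt < ∞ and ∫₀^∞ |g(t)|·t^(α−1) dt < ∞. Then ∫₀^∞ |(f *_α g)(t)|·t^(α−1) dt ≤ (∫₀^∞ |f(t)|·t^(α−1) dt) · (∫₀^∞ |g(t)|·t^(α−1) dt), where |(f *_α g)(t)| is bounded by the integral ∫₀^t |f(p)|·|g((t^α − p^α)^(1/α))|·p^(α−1) dp; in particular f *_α g ∈ L¹_α(0,∞). -/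
open MeasureTheory

/-- Conformable fractional convolution of complex-valued functions:
`(f *_α g)(t) = ∫₀^t f(p)·g((t^α − p^α)^(1/α))·p^(α−1) dp`. -/
noncomputable def conformableConv (α : ℝ) (f g : ℝ → ℂ) (t : ℝ) : ℂ :=
  ∫ p in Set.Ioo 0 t, f p * g ((t ^ α - p ^ α) ^ (1 / α)) * ((p ^ (α - 1) : ℝ) : ℂ)

theorem aux_subst (α : ℝ) (hα0 : 0 < α) (G : ℝ → ENNReal) (p : ℝ) (hp : 0 < p) :
    ∫⁻ t in Set.Ioi p, G ((t ^ α - p ^ α) ^ (1 / α)) * ENNReal.ofReal (t ^ (α - 1)) =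
    ∫⁻ s in Set.Ioi (0 : ℝ), G s * ENNReal.ofReal (s ^ (α - 1)) := by
  have hpα : 0 < p ^ α := Real.rpow_pos_of_pos hp α
  have hαi : 0 < 1 / α := by positivity
  have hinv : ∀ s ∈ Set.Ioi (0 : ℝ),
      ((((s ^ α + p ^ α) ^ (1 / α)) ^ α - p ^ α) ^ (1 / α)) = s := by
    intro s hs
    have hs' : (0 : ℝ) < s := hs
    have h1 : 0 < s ^ α := Real.rpow_pos_of_pos hs' α
    rw [← Real.rpow_mul (by positivity), one_div_mul_cancel hα0.ne', Real.rpow_one,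
      add_sub_cancel_right, ← Real.rpow_mul hs'.le, mul_one_div_cancel hα0.ne', Real.rpow_one]
  have himg : (fun s : ℝ => (s ^ α + p ^ α) ^ (1 / α)) '' Set.Ioi 0 = Set.Ioi p := by
    ext t
    constructor
    · rintro ⟨s, hs, rfl⟩
      have h1 : 0 < s ^ α := Real.rpow_pos_of_pos hs α
      have h2 : (p ^ α) ^ (1 / α) = p := by
        rw [← Real.rpow_mul hp.le, mul_one_div_cancel hα0.ne', Real.rpow_one]
      have h3 : (p ^ α) ^ (1 / α) < (s ^ α + p ^ α) ^ (1 / α) :=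
        Real.rpow_lt_rpow hpα.le (by linarith) hαi
      rw [h2] at h3
      exact h3
    · intro ht
      have ht' : p < t := ht
      have h0 : 0 < t ^ α - p ^ α := sub_pos.2 (Real.rpow_lt_rpow hp.le ht' hα0)
      refine ⟨(t ^ α - p ^ α) ^ (1 / α), Real.rpow_pos_of_pos h0 _, ?_⟩
      show (((t ^ α - p ^ α) ^ (1 / α)) ^ α + p ^ α) ^ (1 / α) = t
      rw [← Real.rpow_mul h0.le, one_div_mul_cancel hα0.ne', Real.rpow_one, sub_add_cancel,
        ← Real.rpow_mul (hp.trans ht').le, mul_one_div_cancel hα0.ne', Real.rpow_one]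
  have hinj : Set.InjOn (fun s : ℝ => (s ^ α + p ^ α) ^ (1 / α)) (Set.Ioi 0) := by
    intro a ha b hb hab
    have hab' : (a ^ α + p ^ α) ^ (1 / α) = (b ^ α + p ^ α) ^ (1 / α) := hab
    rw [← hinv a ha, ← hinv b hb, hab']
  have hder : ∀ s ∈ Set.Ioi (0 : ℝ), HasDerivWithinAt
      (fun s : ℝ => (s ^ α + p ^ α) ^ (1 / α))
      ((α * s ^ (α - 1)) * (1 / α) * (s ^ α + p ^ α) ^ (1 / α - 1)) (Set.Ioi 0) s := by
    intro s hs
    have hs' : (0 : ℝ) < s := hs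
    have h1 : 0 < s ^ α := Real.rpow_pos_of_pos hs' α
    exact (((Real.hasDerivAt_rpow_const (Or.inl hs'.ne')).add_const (p ^ α)).rpow_const
      (Or.inl (by positivity))).hasDerivWithinAt
  rw [← himg, lintegral_image_eq_lintegral_abs_deriv_mul measurableSet_Ioi hder hinj]
  refine setLIntegral_congr_fun measurableSet_Ioi ?_
  intro s hs
  have hs' : (0 : ℝ) < s := hs
  have h1 : 0 < s ^ α := Real.rpow_pos_of_pos hs' α
  have h2 : 0 < s ^ (α - 1) := Real.rpow_pos_of_pos hs' _
  have hu : 0 < s ^ α + p ^ α := by positivity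
  show ENNReal.ofReal |_| * (G ((((s ^ α + p ^ α) ^ (1 / α)) ^ α - p ^ α) ^ (1 / α)) * _) = _
  rw [hinv s hs, mul_left_comm, abs_of_nonneg (by positivity),
    ← ENNReal.ofReal_mul (by positivity)]
  congr 2
  rw [← Real.rpow_mul hu.le]
  have : (s ^ α + p ^ α) ^ (1 / α - 1) * (s ^ α + p ^ α) ^ (1 / α * (α - 1)) = 1 := by
    rw [← Real.rpow_add hu]
    have : 1 / α - 1 + 1 / α * (α - 1) = 0 := by field_simp; ring
    rw [this, Real.rpow_zero]
  have h3 : α * (1 / α) = 1 := mul_one_div_cancel hα0.ne'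
  calc _ = s ^ (α - 1) * (α * (1 / α)) *
      ((s ^ α + p ^ α) ^ (1 / α - 1) * (s ^ α + p ^ α) ^ (1 / α * (α - 1))) := by ring
    _ = _ := by rw [this, h3]; ring

/-- Boundedness of the conformable convolution in `L¹_α`: if `f, g ∈ L¹_α(0,∞)` then
`‖f *_α g‖_{L¹_α} ≤ ‖f‖_{L¹_α}·‖g‖_{L¹_α}`; in particular `f *_α g ∈ L¹_α(0,∞)`. -/
theorem conformableConvolution_L1alpha_bound
    (α : ℝ) (hα0 : 0 < α) (hα1 : α ≤ 1) (f g : ℝ → ℂ)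
    (hf : Measurable f) (hg : Measurable g)
    (hfL : ∫⁻ t in Set.Ioi (0 : ℝ), (‖f t‖₊ : ENNReal) * ENNReal.ofReal (t ^ (α - 1)) < ⊤)
    (hgL : ∫⁻ t in Set.Ioi (0 : ℝ), (‖g t‖₊ : ENNReal) * ENNReal.ofReal (t ^ (α - 1)) < ⊤) :
    (∫⁻ t in Set.Ioi (0 : ℝ),
        (‖conformableConv α f g t‖₊ : ENNReal) * ENNReal.ofReal (t ^ (α - 1)) ≤
      (∫⁻ t in Set.Ioi (0 : ℝ), (‖f t‖₊ : ENNReal) * ENNReal.ofReal (t ^ (α - 1))) *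
      (∫⁻ t in Set.Ioi (0 : ℝ), (‖g t‖₊ : ENNReal) * ENNReal.ofReal (t ^ (α - 1)))) ∧
    ∫⁻ t in Set.Ioi (0 : ℝ),
        (‖conformableConv α f g t‖₊ : ENNReal) * ENNReal.ofReal (t ^ (α - 1)) < ⊤ := by
  have main : (∫⁻ t in Set.Ioi (0 : ℝ),
        (‖conformableConv α f g t‖₊ : ENNReal) * ENNReal.ofReal (t ^ (α - 1)) ≤
      (∫⁻ t in Set.Ioi (0 : ℝ), (‖f t‖₊ : ENNReal) * ENNReal.ofReal (t ^ (α - 1))) *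
      (∫⁻ t in Set.Ioi (0 : ℝ), (‖g t‖₊ : ENNReal) * ENNReal.ofReal (t ^ (α - 1)))) := by
    set B := ∫⁻ t in Set.Ioi (0 : ℝ), (‖g t‖₊ : ENNReal) * ENNReal.ofReal (t ^ (α - 1)) with hB
    let K : ℝ → ℝ → ENNReal := fun t p =>
      (Set.Ioi (0:ℝ)).indicator (fun p => (‖f p‖₊ : ENNReal) * ENNReal.ofReal (p ^ (α - 1))) p *
      ({q : ℝ × ℝ | q.2 < q.1}.indicator (fun q : ℝ × ℝ =>
        (‖g ((q.1 ^ α - q.2 ^ α) ^ (1 / α))‖₊ : ENNReal) * ENNReal.ofReal (q.1 ^ (α - 1))) (t, p))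
    have hKm : Measurable (Function.uncurry K) := by
      have m1 : Measurable (fun p : ℝ => (‖f p‖₊ : ENNReal) * ENNReal.ofReal (p ^ (α - 1))) := by
        fun_prop
      have m2 : Measurable (fun q : ℝ × ℝ =>
        (‖g ((q.1 ^ α - q.2 ^ α) ^ (1 / α))‖₊ : ENNReal) * ENNReal.ofReal (q.1 ^ (α - 1))) := by
        fun_prop
      exact ((m1.indicator measurableSet_Ioi).comp measurable_snd).mul
        (m2.indicator (measurableSet_lt measurable_snd measurable_fst))
    have hpt : ∀ t : ℝ, (‖conformableConv α f g t‖₊ : ENNReal) * ENNReal.ofReal (t ^ (α - 1))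
        ≤ ∫⁻ p, K t p := by
      intro t
      have h1 : (‖conformableConv α f g t‖₊ : ENNReal) ≤ ∫⁻ p in Set.Ioo 0 t,
          ‖f p * g ((t ^ α - p ^ α) ^ (1 / α)) * ((p ^ (α - 1) : ℝ) : ℂ)‖ₑ :=
        enorm_integral_le_lintegral_enorm _
      refine (mul_le_mul_left h1 _).trans ?_
      rw [← lintegral_mul_const' _ _ ENNReal.ofReal_ne_top, ← lintegral_indicator measurableSet_Ioo]
      refine lintegral_mono fun p => ?_
      by_cases hp : p ∈ Set.Ioo 0 t
      · have e1 : p ∈ Set.Ioi (0:ℝ) := hp.1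
        have e2 : (t, p) ∈ {q : ℝ × ℝ | q.2 < q.1} := hp.2
        simp only [K, Set.indicator_of_mem hp, Set.indicator_of_mem e1, Set.indicator_of_mem e2]
        have e3 : ‖((p ^ (α - 1) : ℝ) : ℂ)‖ₑ = ENNReal.ofReal (p ^ (α - 1)) := by
          rw [← ofReal_norm, Complex.norm_real, Real.norm_of_nonneg (Real.rpow_nonneg hp.1.le _)]
        rw [enorm_mul, enorm_mul, e3]
        simp only [← enorm_eq_nnnorm]
        apply le_of_eq
        ring
      · rw [Set.indicator_of_notMem hp]
        exact zero_le
    have hK2 : ∀ p : ℝ, ∫⁻ t in Set.Ioi (0:ℝ), K t p =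
        (Set.Ioi (0:ℝ)).indicator
          (fun p => (‖f p‖₊ : ENNReal) * ENNReal.ofReal (p ^ (α - 1)) * B) p := by
      intro p
      by_cases hp : p ∈ Set.Ioi (0:ℝ)
      · rw [Set.indicator_of_mem hp]
        simp only [K, Set.indicator_of_mem hp]
        rw [lintegral_const_mul' _ _ (ENNReal.mul_ne_top ENNReal.coe_ne_top ENNReal.ofReal_ne_top),
          hB, ← aux_subst α hα0 (fun s => (‖g s‖₊ : ENNReal)) p hp]
        congr 1
        rw [← lintegral_indicator measurableSet_Ioi, ← lintegral_indicator measurableSet_Ioi]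
        refine lintegral_congr fun t => ?_
        have hp' : 0 < p := hp
        by_cases ht : p < t
        · simp [Set.indicator, ht, hp'.trans ht]
        · simp [Set.indicator, ht]
      · rw [Set.indicator_of_notMem hp]
        simp only [K, Set.indicator_of_notMem hp, zero_mul, lintegral_zero]
    calc _ ≤ ∫⁻ t in Set.Ioi (0:ℝ), ∫⁻ p, K t p := lintegral_mono hpt
      _ = ∫⁻ p, ∫⁻ t in Set.Ioi (0:ℝ), K t p := lintegral_lintegral_swap hKm.aemeasurable
      _ = _ := by
        rw [lintegral_congr hK2, lintegral_indicator measurableSet_Ioi,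
          lintegral_mul_const' _ _ hgL.ne]
  exact ⟨main, main.trans_lt (ENNReal.mul_lt_top hfL hgL)⟩
end

section
/- (Young's inequality in L^n_α) Let 0 < α ≤ 1, let 1 ≤ n < ∞ be a real number, and let f, g : (0,∞) → ℂ be measurable with ∫₀^∞ |f(t)|·t^(α−1) dt < ∞ and ∫₀^∞ |g(t)|^n·t^(α−1) dt < ∞. Then (∫₀^∞ |(f *_α g)(t)|^n·t^(α−1) dt)^(1/n) ≤ (∫₀^∞ |f(t)|·t^(α−1) dt) · (∫₀^∞ |g(t)|^n·t^(α−1) dt)^(1/n); in particular f *_α g ∈ L^n_α(0,∞). -/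
open MeasureTheory

lemma cc_change (α : ℝ) (hα0 : 0 < α) (p : ℝ) (hp : 0 < p) (h : ℝ → ENNReal) :
    ∫⁻ t in Set.Ioi p, h ((t ^ α - p ^ α) ^ (1 / α)) * ENNReal.ofReal (t ^ (α - 1)) =
    ∫⁻ s in Set.Ioi (0 : ℝ), h s * ENNReal.ofReal (s ^ (α - 1)) := by
  have hpa : 0 < p ^ α := Real.rpow_pos_of_pos hp α
  have himg : (fun s : ℝ => (s ^ α + p ^ α) ^ (1 / α)) '' Set.Ioi 0 = Set.Ioi p := by
    ext t
    simp only [Set.mem_image, Set.mem_Ioi]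
    constructor
    · rintro ⟨s, hs, rfl⟩
      have hsa : 0 < s ^ α := Real.rpow_pos_of_pos hs α
      calc p = (p ^ α) ^ (1 / α) := by
            rw [← Real.rpow_mul hp.le, mul_one_div_cancel hα0.ne', Real.rpow_one]
        _ < _ := Real.rpow_lt_rpow hpa.le (by linarith) (by positivity)
    · intro ht
      have h1 : p ^ α < t ^ α := Real.rpow_lt_rpow hp.le ht hα0
      refine ⟨(t ^ α - p ^ α) ^ (1 / α), Real.rpow_pos_of_pos (by linarith) _, ?_⟩
      rw [← Real.rpow_mul (by linarith : 0 ≤ t ^ α - p ^ α), one_div_mul_cancel hα0.ne',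
        Real.rpow_one, sub_add_cancel, ← Real.rpow_mul (by linarith),
        mul_one_div_cancel hα0.ne', Real.rpow_one]
  have hinv : ∀ s ∈ Set.Ioi (0 : ℝ),
      ((((s ^ α + p ^ α) ^ (1 / α)) ^ α - p ^ α) ^ (1 / α)) = s := by
    intro s hs
    have hs : 0 < s := hs
    have hsa : 0 < s ^ α := Real.rpow_pos_of_pos hs α
    rw [← Real.rpow_mul (by linarith : 0 ≤ s ^ α + p ^ α), one_div_mul_cancel hα0.ne',
      Real.rpow_one, add_sub_cancel_right, ← Real.rpow_mul hs.le,
      mul_one_div_cancel hα0.ne', Real.rpow_one]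
  have hinj : Set.InjOn (fun s : ℝ => (s ^ α + p ^ α) ^ (1 / α)) (Set.Ioi 0) := by
    intro a ha b hb hab
    simp only at hab
    rw [← hinv a ha, hab, hinv b hb]
  have hder : ∀ s ∈ Set.Ioi (0 : ℝ), HasDerivWithinAt (fun s : ℝ => (s ^ α + p ^ α) ^ (1 / α))
      ((α * s ^ (α - 1)) * (1 / α) * (s ^ α + p ^ α) ^ (1 / α - 1)) (Set.Ioi 0) s := by
    intro s hs
    have hs : 0 < s := hs
    have hsa : 0 < s ^ α := Real.rpow_pos_of_pos hs α
    have h1 : HasDerivAt (fun s : ℝ => s ^ α + p ^ α) (α * s ^ (α - 1)) s :=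
      (Real.hasDerivAt_rpow_const (Or.inl hs.ne')).add_const _
    exact (h1.rpow_const (p := 1 / α) (Or.inl (by positivity))).hasDerivWithinAt
  rw [← himg, lintegral_image_eq_lintegral_abs_deriv_mul measurableSet_Ioi hder hinj]
  refine setLIntegral_congr_fun measurableSet_Ioi ?_
  intro s hs
  have e := hinv s hs
  have hs : 0 < s := hs
  have hsa : 0 < s ^ α := Real.rpow_pos_of_pos hs α
  have hs1 : 0 < s ^ (α - 1) := Real.rpow_pos_of_pos hs _
  simp only [e]
  rw [mul_left_comm, ← ENNReal.ofReal_mul (abs_nonneg _)]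
  congr 2
  rw [abs_of_nonneg (by positivity), ← Real.rpow_mul (by positivity), mul_assoc,
    ← Real.rpow_add (by positivity)]
  have : (1 / α - 1) + 1 / α * (α - 1) = 0 := by field_simp; ring
  rw [this, Real.rpow_zero]
  field_simp

lemma cc_holder (μ : Measure ℝ) (n : ℝ) (hn : 1 ≤ n) (u v : ℝ → ENNReal)
    (hu : Measurable u) (hv : Measurable v) :
    (∫⁻ p, u p * v p ∂μ) ^ n ≤ (∫⁻ p, u p * v p ^ n ∂μ) * (∫⁻ p, u p ∂μ) ^ (n - 1) := by
  have hn0 : 0 < n := by linarith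
  have key := eLpNorm'_le_eLpNorm'_mul_rpow_measure_univ (f := v) (μ := μ.withDensity u)
    zero_lt_one hn hv.aestronglyMeasurable
  simp only [eLpNorm', enorm_eq_self, ENNReal.rpow_one, div_one] at key
  rw [lintegral_withDensity_eq_lintegral_mul _ hu hv,
    lintegral_withDensity_eq_lintegral_mul _ hu (hv.pow_const n),
    withDensity_apply _ MeasurableSet.univ, Measure.restrict_univ] at key
  simp only [Pi.mul_apply] at key
  have := ENNReal.rpow_le_rpow key hn0.le
  rw [ENNReal.mul_rpow_of_nonneg _ _ hn0.le, ← ENNReal.rpow_mul, ← ENNReal.rpow_mul,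
    one_div_mul_cancel hn0.ne', ENNReal.rpow_one] at this
  convert this using 3
  field_simp

lemma cc_main (α : ℝ) (hα0 : 0 < α) (n : ℝ) (hn : 1 ≤ n) (f g : ℝ → ℂ)
    (hf : Measurable f) (hg : Measurable g) :
    (∫⁻ t in Set.Ioi (0 : ℝ),
        (‖conformableConv α f g t‖₊ : ENNReal) ^ n * ENNReal.ofReal (t ^ (α - 1))) ≤
      (∫⁻ t in Set.Ioi (0 : ℝ), (‖f t‖₊ : ENNReal) * ENNReal.ofReal (t ^ (α - 1))) ^ n *
      (∫⁻ t in Set.Ioi (0 : ℝ),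
        (‖g t‖₊ : ENNReal) ^ n * ENNReal.ofReal (t ^ (α - 1))) := by
  have hn0 : 0 < n := by linarith
  set A := ∫⁻ t in Set.Ioi (0 : ℝ), (‖f t‖₊ : ENNReal) * ENNReal.ofReal (t ^ (α - 1)) with hA
  set B := ∫⁻ t in Set.Ioi (0 : ℝ),
        (‖g t‖₊ : ENNReal) ^ n * ENNReal.ofReal (t ^ (α - 1)) with hB
  let u : ℝ → ENNReal := fun p => (‖f p‖₊ : ENNReal) * ENNReal.ofReal (p ^ (α - 1))
  have hu : Measurable u := by fun_prop
  let v : ℝ → ℝ → ENNReal := fun t p => (‖g ((t ^ α - p ^ α) ^ (1 / α))‖₊ : ENNReal)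
  have hv2 : Measurable (fun q : ℝ × ℝ => v q.1 q.2) := by fun_prop
  have hv : ∀ t, Measurable (v t) := fun t => by fun_prop
  let S : Set (ℝ × ℝ) := {q | q.2 < q.1}
  have hS : MeasurableSet S := measurableSet_lt measurable_snd measurable_fst
  let K : ℝ × ℝ → ENNReal := S.indicator
    (fun q => u q.2 * v q.1 q.2 ^ n * ENNReal.ofReal (q.1 ^ (α - 1)))
  have hK : Measurable K := by
    refine Measurable.indicator ?_ hS
    exact ((hu.comp measurable_snd).mul (hv2.pow_const n)).mul (by fun_prop)
  have h1 : ∀ t ∈ Set.Ioi (0 : ℝ),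
      (‖conformableConv α f g t‖₊ : ENNReal) ^ n * ENNReal.ofReal (t ^ (α - 1)) ≤
      (∫⁻ p in Set.Ioi (0 : ℝ), K (t, p)) * A ^ (n - 1) := by
    intro t ht
    have ha : (‖conformableConv α f g t‖₊ : ENNReal) ≤ ∫⁻ p in Set.Ioo 0 t, u p * v t p := by
      refine (enorm_integral_le_lintegral_enorm _).trans (le_of_eq ?_)
      refine setLIntegral_congr_fun measurableSet_Ioo ?_
      intro p hp
      have : 0 ≤ p ^ (α - 1) := Real.rpow_nonneg hp.1.le _
      simp only [enorm_mul, u, v]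
      rw [mul_right_comm]
      congr 2
      rw [← ofReal_norm, Complex.norm_real, Real.norm_of_nonneg this]
    have hc : (∫⁻ p in Set.Ioo 0 t, u p * v t p ^ n) * ENNReal.ofReal (t ^ (α - 1)) =
        ∫⁻ p in Set.Ioi (0 : ℝ), K (t, p) := by
      rw [← lintegral_mul_const (f := fun p => u p * v t p ^ n) _ (hu.mul ((hv t).pow_const n))]
      have : ∀ p, K (t, p) = (Set.Iio t).indicator
          (fun p => u p * v t p ^ n * ENNReal.ofReal (t ^ (α - 1))) p := by
        intro p; simp [K, S, Set.indicator]
      simp_rw [this]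
      rw [setLIntegral_indicator measurableSet_Iio, Set.inter_comm, Set.Ioi_inter_Iio]
    calc _ ≤ (∫⁻ p in Set.Ioo 0 t, u p * v t p) ^ n * ENNReal.ofReal (t ^ (α - 1)) := by
          gcongr
      _ ≤ ((∫⁻ p in Set.Ioo 0 t, u p * v t p ^ n) * (∫⁻ p in Set.Ioo 0 t, u p) ^ (n - 1))
            * ENNReal.ofReal (t ^ (α - 1)) := by
          gcongr
          exact cc_holder _ n hn u (v t) hu (hv t)
      _ ≤ ((∫⁻ p in Set.Ioo 0 t, u p * v t p ^ n) * A ^ (n - 1))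
            * ENNReal.ofReal (t ^ (α - 1)) := by
          gcongr
          exact lintegral_mono_set Set.Ioo_subset_Ioi_self
      _ = _ := by rw [mul_right_comm, hc]
  refine (setLIntegral_mono' measurableSet_Ioi h1).trans ?_
  rw [lintegral_mul_const _ hK.lintegral_prod_right', lintegral_lintegral_swap (f := fun t p => K (t, p))
      hK.aemeasurable]
  have h2 : ∫⁻ p in Set.Ioi (0 : ℝ), ∫⁻ t in Set.Ioi (0 : ℝ), K (t, p) = A * B := by
    rw [hA, ← lintegral_mul_const _ hu]
    refine setLIntegral_congr_fun measurableSet_Ioi ?_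
    intro p hp
    have hp : 0 < p := hp
    have : ∀ t, K (t, p) = (Set.Ioi p).indicator
          (fun t => u p * (v t p ^ n * ENNReal.ofReal (t ^ (α - 1)))) t := by
      intro t; simp [K, S, Set.indicator, mul_assoc]
    simp_rw [this]
    rw [setLIntegral_indicator measurableSet_Ioi, Set.Ioi_inter_Ioi, max_eq_left hp.le,
      lintegral_const_mul _ (by fun_prop)]
    congr 1
    exact cc_change α hα0 p hp (fun x => (‖g x‖₊ : ENNReal) ^ n)
  rw [h2]
  have h3 : A ^ n = A * A ^ (n - 1) := by
    conv_lhs => rw [show n = 1 + (n - 1) by ring]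
    rw [ENNReal.rpow_add_of_nonneg _ _ zero_le_one (by linarith), ENNReal.rpow_one]
  rw [h3, mul_right_comm]

/-- Young's inequality in `L^n_α`: if `f ∈ L¹_α(0,∞)` and `g ∈ L^n_α(0,∞)` with
`1 ≤ n < ∞`, then `‖f *_α g‖_{L^n_α} ≤ ‖f‖_{L¹_α}·‖g‖_{L^n_α}`;
in particular `f *_α g ∈ L^n_α(0,∞)`. -/
theorem conformableConvolution_young
    (α : ℝ) (hα0 : 0 < α) (hα1 : α ≤ 1) (n : ℝ) (hn : 1 ≤ n) (f g : ℝ → ℂ)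
    (hf : Measurable f) (hg : Measurable g)
    (hfL : ∫⁻ t in Set.Ioi (0 : ℝ), (‖f t‖₊ : ENNReal) * ENNReal.ofReal (t ^ (α - 1)) < ⊤)
    (hgL : ∫⁻ t in Set.Ioi (0 : ℝ),
      (‖g t‖₊ : ENNReal) ^ n * ENNReal.ofReal (t ^ (α - 1)) < ⊤) :
    ((∫⁻ t in Set.Ioi (0 : ℝ),
        (‖conformableConv α f g t‖₊ : ENNReal) ^ n * ENNReal.ofReal (t ^ (α - 1))) ^ (1 / n) ≤
      (∫⁻ t in Set.Ioi (0 : ℝ), (‖f t‖₊ : ENNReal) * ENNReal.ofReal (t ^ (α - 1))) *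
      (∫⁻ t in Set.Ioi (0 : ℝ),
        (‖g t‖₊ : ENNReal) ^ n * ENNReal.ofReal (t ^ (α - 1))) ^ (1 / n)) ∧
    ∫⁻ t in Set.Ioi (0 : ℝ),
        (‖conformableConv α f g t‖₊ : ENNReal) ^ n * ENNReal.ofReal (t ^ (α - 1)) < ⊤ := by
  have hn0 : 0 < n := by linarith
  have key := cc_main α hα0 n hn f g hf hg
  refine ⟨?_, key.trans_lt
    (ENNReal.mul_lt_top (ENNReal.rpow_lt_top_of_nonneg hn0.le hfL.ne) hgL)⟩
  have h := ENNReal.rpow_le_rpow key (z := 1 / n) (by positivity)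
  rwa [ENNReal.mul_rpow_of_nonneg _ _ (by positivity), ← ENNReal.rpow_mul,
    mul_one_div_cancel hn0.ne', ENNReal.rpow_one] at h
end
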